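/- Let W : ℝ → ℂ be a fixed smooth function with compact support contained in (0, ∞), and fix constants 0 < c1 ≤ c2 and ε > 0. (i) There exists C = C(W, c1, c2, ε) such that for every T > 1, every integer d ≥ 2 with c1·T ≤ d ≤ c2·T, every r = i·ρ with ρ ∈ ℝ and c1·T ≤ |ρ| ≤ c2·T, and every real Ξ with |Ξ| > 1, one has |K̃_{d,r}(Ξ, 0, 0)| ≤ C · T^{−3/2+ε}. (ii) For every B ≥ 0 there exists C' = C'(W, c1, c2, ε, B) such that, under the same hypotheses, if in addition |Ξ| ≥ T^{3+ε} then |K̃_{d,r}(Ξ, 0, 0)| ≤ C' · T^{−B}. -/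

import Mathlib

open MeasureTheory Finset Set
open scoped Real

noncomputable section

/-- `e(x) = exp(2πi x)`. -/
def eFn (x : ℝ) : ℂ := Complex.exp (2 * (Real.pi : ℂ) * Complex.I * (x : ℂ))

/-- `Q(d,s) = Γ((d−1)/2 + s)/Γ((d+1)/2 − s)`. -/
def Qfun (d : ℕ) (s : ℂ) : ℂ :=
  Complex.Gamma (((d : ℂ) - 1) / 2 + s) / Complex.Gamma (((d : ℂ) + 1) / 2 - s)

/-- The `w₄` Bessel kernel `K_{w₄}(y; d, r)`, written as an integral over the vertical
line `Re s = 1/12` (a fixed choice of `σ ∈ (0, 1/6)`; the value is independent of this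
choice): `K_{w₄}(y;d,r) = ((εi)^d/4π²) ∫ |8π³y|^{1−r−s} Q(d,s) Γ(s+3r) e^{εiπ(s+3r)/2}
ds/(2πi)` with `ε = sgn y`. -/
def Kw4 (y : ℝ) (d : ℕ) (r : ℂ) : ℂ :=
  (((Real.sign y : ℂ) * Complex.I) ^ d / (4 * (Real.pi : ℂ) ^ 2)) *
    (1 / (2 * (Real.pi : ℂ))) *
    ∫ t : ℝ,
      ((|8 * Real.pi ^ 3 * y| : ℝ) : ℂ) ^
          ((1 : ℂ) - r - ((1 / 12 : ℂ) + (t : ℂ) * Complex.I)) *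
        Qfun d ((1 / 12 : ℂ) + (t : ℂ) * Complex.I) *
        Complex.Gamma ((1 / 12 : ℂ) + (t : ℂ) * Complex.I + 3 * r) *
        Complex.exp ((Real.sign y : ℂ) * Complex.I * (Real.pi : ℂ) *
          ((1 / 12 : ℂ) + (t : ℂ) * Complex.I + 3 * r) / 2)

/-- `K̃_{d,r}(Ξ, U, V) = (1/|Ξ|) ∫₀^∞ ∫₀^∞ K_{w₄}(ξηΞ; d, r) e(ξU + ηV) W(ξ) W(η) dξ dη`. -/
def Ktilde (W : ℝ → ℂ) (d : ℕ) (r : ℂ) (Ξ U V : ℝ) : ℂ :=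
  (1 / ((|Ξ| : ℝ) : ℂ)) *
    ∫ ξ in Set.Ioi (0 : ℝ), ∫ η in Set.Ioi (0 : ℝ),
      Kw4 (ξ * η * Ξ) d r * eFn (ξ * U + η * V) * W ξ * W η

/-- partial sums -/
def fj (t x : ℝ) : ℝ := Real.log x - Real.log ‖(x : ℂ) + t * Complex.I‖

lemma fj_eq (t x : ℝ) : fj t x = Real.log x - 1/2 * Real.log (x^2+t^2) := by
  unfold fj
  have : ‖(x : ℂ) + t * Complex.I‖ = Real.sqrt (x^2+t^2) := Complex.norm_add_mul_I x t
  rw [this, Real.log_sqrt (by positivity)]; ring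

lemma fj_deriv (t x : ℝ) (hx : 0 < x) : HasDerivAt (fj t) (t^2/(x*(x^2+t^2))) x := by
  have h0 : x^2+t^2 ≠ 0 := by positivity
  have h1 : HasDerivAt (fun x : ℝ => x^2+t^2) (2*x) x := by
    simpa using (hasDerivAt_pow 2 x).add_const (t^2)
  have h : HasDerivAt (fun x => Real.log x - 1/2 * Real.log (x^2+t^2)) (x⁻¹ - 1/2 * (2*x/(x^2+t^2))) x :=
    (Real.hasDerivAt_log hx.ne').sub ((h1.log h0).const_mul (1/2))
  have e : fj t = fun x => Real.log x - 1/2 * Real.log (x^2+t^2) := funext (fj_eq t)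
  rw [e]
  refine h.congr_deriv ?_
  field_simp
  ring

lemma fj_concave (t : ℝ) : ConcaveOn ℝ (Ioi 0) (fj t) := by
  apply AntitoneOn.concaveOn_of_deriv (convex_Ioi 0)
  · exact fun x hx => (fj_deriv t x hx).continuousAt.continuousWithinAt
  · rw [interior_Ioi]
    exact fun x hx => (fj_deriv t x hx).differentiableAt.differentiableWithinAt
  · rw [interior_Ioi]
    intro x hx y hy hxy
    rw [(fj_deriv t x hx).deriv, (fj_deriv t y hy).deriv]
    have hx' : 0 < x := hx
    have hy' : 0 < y := hy
    gcongr

lemma fj_mono (t : ℝ) : MonotoneOn (fj t) (Ioi 0) := by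
  apply monotoneOn_of_deriv_nonneg (convex_Ioi 0)
  · exact fun x hx => (fj_deriv t x hx).continuousAt.continuousWithinAt
  · rw [interior_Ioi]
    exact fun x hx => (fj_deriv t x hx).differentiableAt.differentiableWithinAt
  · rw [interior_Ioi]
    intro x hx
    rw [(fj_deriv t x hx).deriv]
    have hx' : 0 < x := hx
    positivity

def HG (t x : ℝ) : ℝ := Real.log ‖Complex.Gamma (x + t * Complex.I)‖ - Real.log (Real.Gamma x)

lemma Gne (t x : ℝ) (hx : 0 < x) : Complex.Gamma (x + t * Complex.I) ≠ 0 :=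
  Complex.Gamma_ne_zero_of_re_pos (by simpa using hx)

lemma HG_tendsto (t x : ℝ) (hx : 0 < x) :
    Filter.Tendsto (fun n : ℕ => ∑ j ∈ range (n+1), fj t (x + j)) Filter.atTop (nhds (HG t x)) := by
  have h1 : Filter.Tendsto (fun n : ℕ => Real.log ‖Complex.GammaSeq (x + t * Complex.I) n‖) Filter.atTop
      (nhds (Real.log ‖Complex.Gamma (x + t * Complex.I)‖)) :=
    (Complex.GammaSeq_tendsto_Gamma _).norm.log (by simpa using Gne t x hx)
  have h2 : Filter.Tendsto (fun n : ℕ => Real.log ‖Complex.GammaSeq (x + (0:ℝ) * Complex.I) n‖) Filter.atTop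
      (nhds (Real.log ‖Complex.Gamma (x + (0:ℝ) * Complex.I)‖)) :=
    (Complex.GammaSeq_tendsto_Gamma _).norm.log (by simpa using Gne 0 x hx)
  have e : HG t x = Real.log ‖Complex.Gamma (x + t * Complex.I)‖ - Real.log ‖Complex.Gamma (x + (0:ℝ) * Complex.I)‖ := by
    unfold HG
    congr 2
    have : (x:ℂ) + (0:ℝ) * Complex.I = x := by simp
    rw [this, Complex.Gamma_ofReal, Complex.norm_real, Real.norm_of_nonneg (Real.Gamma_pos_of_pos hx).le]
  rw [e]
  refine (h1.sub h2).congr' ?_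
  filter_upwards [Filter.eventually_ge_atTop 1] with n hn
  have key : ∀ t : ℝ, Real.log ‖Complex.GammaSeq (x + t * Complex.I) n‖ = Real.log ((n:ℝ)^x * n.factorial) -
      ∑ j ∈ range (n+1), Real.log ‖((x + j : ℝ) : ℂ) + t * Complex.I‖ := by
    intro t
    have hn0 : (0:ℝ) < n := by exact_mod_cast hn
    have hne : ∀ j ∈ range (n+1), ‖((x + j : ℝ) : ℂ) + t * Complex.I‖ ≠ 0 := by
      intro j _ h
      rw [norm_eq_zero] at h
      have := congrArg Complex.re h
      simp at this
      have : (0:ℝ) ≤ j := Nat.cast_nonneg j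
      linarith
    unfold Complex.GammaSeq
    rw [norm_div, norm_mul, norm_prod]
    have e1 : ‖(n:ℂ) ^ ((x:ℂ) + t * Complex.I)‖ = (n:ℝ)^x := by
      have := Complex.norm_cpow_eq_rpow_re_of_pos hn0 ((x:ℂ) + t * Complex.I)
      simpa using this
    have e2 : ∏ j ∈ range (n+1), ‖(x:ℂ) + t * Complex.I + j‖ = ∏ j ∈ range (n+1), ‖((x + j : ℝ) : ℂ) + t * Complex.I‖ := by
      apply prod_congr rfl
      intro j _
      congr 1
      push_cast; ring
    rw [e1, e2, Real.log_div, Real.log_prod hne]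
    · simp
    · have := n.factorial_ne_zero
      simp only [RCLike.norm_natCast]
      positivity
    · exact prod_ne_zero_iff.2 hne
  rw [key t, key 0, sub_sub_sub_cancel_left, ← sum_sub_distrib]
  apply sum_congr rfl
  intro j _
  unfold fj
  have : (0:ℝ) ≤ x + j := by positivity
  simp only [Complex.ofReal_zero, zero_mul, add_zero, Complex.norm_real, Real.norm_of_nonneg this]

lemma HG_mono (t : ℝ) {x y : ℝ} (hx : 0 < x) (hxy : x ≤ y) : HG t x ≤ HG t y := by
  refine le_of_tendsto_of_tendsto' (HG_tendsto t x hx) (HG_tendsto t y (hx.trans_le hxy)) fun n => ?_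
  apply sum_le_sum
  intro j _
  apply fj_mono t _ _ (by linarith)
  · show 0 < x + j
    positivity
  · have : 0 < y := hx.trans_le hxy
    show 0 < y + j
    positivity

lemma HG_concave (t : ℝ) {x y a b : ℝ} (hx : 0 < x) (hy : 0 < y) (ha : 0 ≤ a) (hb : 0 ≤ b) (hab : a + b = 1) :
    a * HG t x + b * HG t y ≤ HG t (a * x + b * y) := by
  have hp : 0 < a * x + b * y := by
    have := (convex_Ioi (0:ℝ)) hx hy ha hb hab
    simpa using this
  refine le_of_tendsto_of_tendsto' (((HG_tendsto t x hx).const_mul a).add ((HG_tendsto t y hy).const_mul b))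
    (HG_tendsto t _ hp) fun n => ?_
  rw [mul_sum, mul_sum, ← sum_add_distrib]
  apply sum_le_sum
  intro j _
  have hx' : x + j ∈ Ioi (0:ℝ) := by show 0 < x + j; positivity
  have hy' : y + j ∈ Ioi (0:ℝ) := by show 0 < y + j; positivity
  have := (fj_concave t).2 hx' hy' ha hb hab
  simp only [smul_eq_mul] at this
  refine this.trans (le_of_eq ?_)
  congr 1
  linear_combination (j:ℝ) * hab

/-- monotonicity of `|Γ(x+it)|/Γ(x)` -/
lemma Gamma_mono (t : ℝ) {x y : ℝ} (hx : 0 < x) (hxy : x ≤ y) :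
    ‖Complex.Gamma (x + t * Complex.I)‖ ≤ Real.Gamma x / Real.Gamma y * ‖Complex.Gamma (y + t * Complex.I)‖ := by
  have hy := hx.trans_le hxy
  have h := HG_mono t hx hxy
  unfold HG at h
  have a1 := norm_pos_iff.2 (Gne t x hx)
  have a2 := norm_pos_iff.2 (Gne t y hy)
  have a3 := Real.Gamma_pos_of_pos hx
  have a4 := Real.Gamma_pos_of_pos hy
  rw [← Real.log_le_log_iff a1 (by positivity), Real.log_mul (by positivity) (by positivity), Real.log_div (by positivity) (by positivity)]
  linarith

/-- key convexity estimate -/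
lemma Gamma_key (t : ℝ) {x θ : ℝ} (hx : 0 < x) (h0 : 0 ≤ θ) (h1 : θ ≤ 1) :
    ‖Complex.Gamma (x + t * Complex.I)‖ ≤
      (x+θ)/x * ‖((x+θ : ℝ) : ℂ) + t * Complex.I‖^(-θ) * ‖Complex.Gamma ((x+θ:ℝ) + t * Complex.I)‖ := by
  have hxt : 0 < x + θ := by positivity
  have hz : ((x+θ : ℝ) : ℂ) + t * Complex.I ≠ 0 := by
    intro h
    have := congrArg Complex.re h
    simp at this
    linarith
  have hzn := norm_pos_iff.2 hz
  have a1 := norm_pos_iff.2 (Gne t x hx)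
  have a2 := norm_pos_iff.2 (Gne t _ hxt)
  have a3 := Real.Gamma_pos_of_pos hx
  have a4 := Real.Gamma_pos_of_pos hxt
  have c1 := HG_concave t (x := x) (y := x + θ + 1) (a := 1/(1+θ)) (b := θ/(1+θ)) hx (by positivity) (by positivity) (by positivity) (by field_simp)
  have e1 : 1/(1+θ) * x + θ/(1+θ) * (x+θ+1) = x + θ := by field_simp; ring
  rw [e1] at c1
  have c2 : HG t x + θ * HG t (x+θ+1) ≤ (1+θ) * HG t (x+θ) := by
    have := mul_le_mul_of_nonneg_left c1 (show 0 ≤ 1+θ by positivity)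
    refine le_trans (le_of_eq ?_) this
    field_simp
  have e2 : HG t (x+θ+1) = HG t (x+θ) + Real.log ‖((x+θ : ℝ) : ℂ) + t * Complex.I‖ - Real.log (x+θ) := by
    unfold HG
    have : (((x+θ+1 : ℝ) : ℂ) + t * Complex.I) = (((x+θ : ℝ) : ℂ) + t * Complex.I) + 1 := by push_cast; ring
    rw [this, Complex.Gamma_add_one _ hz, Real.Gamma_add_one hxt.ne', norm_mul, Real.log_mul hzn.ne' a2.ne', Real.log_mul hxt.ne' a4.ne']
    ring
  have hx1 : x + θ ∈ Ioi (0:ℝ) := hxt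
  have hx2 : x + θ + 1 ∈ Ioi (0:ℝ) := by
    show 0 < x + θ + 1
    positivity
  have c3 := Real.convexOn_log_Gamma.2 hx1 hx2 h0 (show 0 ≤ 1 - θ by linarith) (by ring)
  have e3 : θ * (x+θ) + (1-θ) * (x+θ+1) = x + 1 := by ring
  simp only [smul_eq_mul, Function.comp, e3] at c3
  rw [Real.Gamma_add_one hxt.ne', Real.Gamma_add_one hx.ne', Real.log_mul hxt.ne' a4.ne', Real.log_mul hx.ne' a3.ne'] at c3
  have hp : 0 < ‖((x+θ : ℝ) : ℂ) + t * Complex.I‖^(-θ) := by positivity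
  rw [← Real.log_le_log_iff a1 (by positivity), Real.log_mul (by positivity) a2.ne', Real.log_mul (by positivity) hp.ne', Real.log_div hxt.ne' hx.ne', Real.log_rpow hzn]
  rw [e2] at c2
  unfold HG at c2
  linarith

/-- half-line bound -/
lemma Gamma_half (t : ℝ) : ‖Complex.Gamma ((1/2 : ℝ) + t * Complex.I)‖ * Real.exp (π * |t| / 2) ≤ 3 := by
  have h := Complex.Gamma_mul_Gamma_one_sub ((1/2 : ℝ) + t * Complex.I)
  have e1 : 1 - (((1/2 : ℝ):ℂ) + t * Complex.I) = (starRingEnd ℂ) (((1/2 : ℝ):ℂ) + t * Complex.I) := by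
    simp only [map_add, map_mul, Complex.conj_ofReal, Complex.conj_I]
    push_cast; ring
  rw [e1, Complex.Gamma_conj] at h
  have h2 := congrArg norm h
  rw [norm_mul, RCLike.norm_conj, norm_div] at h2
  have e3 : Complex.sin (π * (((1/2 : ℝ):ℂ) + t * Complex.I)) = (Real.cosh (π * t) : ℝ) := by
    have : (π : ℂ) * (((1/2 : ℝ):ℂ) + t * Complex.I) = ((π * t : ℝ) : ℂ) * Complex.I + π/2 := by push_cast; ring
    rw [this, Complex.sin_add_pi_div_two, Complex.cos_mul_I, Complex.ofReal_cosh]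
  rw [e3, Complex.norm_real, Complex.norm_real, Real.norm_of_nonneg Real.pi_pos.le, Real.norm_of_nonneg (Real.cosh_pos _).le] at h2
  set g := ‖Complex.Gamma (((1/2 : ℝ):ℂ) + t * Complex.I)‖
  have hc : Real.exp (π * |t|) / 2 ≤ Real.cosh (π * t) := by
    rw [← Real.cosh_abs, abs_mul, abs_of_pos Real.pi_pos, Real.cosh_eq]
    have := Real.exp_pos (-(π * |t|))
    linarith
  have he : Real.exp (π * |t| / 2) * Real.exp (π * |t| / 2) = Real.exp (π * |t|) := by
    rw [← Real.exp_add]; congr 1; ring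
  have hcp := Real.cosh_pos (π * t)
  rw [eq_div_iff hcp.ne'] at h2
  have hg : 0 ≤ g := norm_nonneg _
  have : (g * Real.exp (π * |t| / 2))^2 ≤ 3^2 := by
    have : (g * Real.exp (π * |t| / 2))^2 = g*g*Real.exp (π * |t|) := by rw [← he]; ring
    rw [this]
    have := mul_le_mul_of_nonneg_left hc (mul_nonneg hg hg)
    have := Real.pi_lt_four
    linarith
  exact abs_le_of_sq_le_sq' this (by norm_num) |>.2

lemma norm_re_im_le (x t : ℝ) (hx : 0 ≤ x) : ‖(x:ℂ) + t * Complex.I‖ ≤ x + |t| := by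
  refine (norm_add_le _ _).trans ?_
  simp [abs_of_nonneg hx]

lemma le_norm_re (x t : ℝ) : x ≤ ‖(x:ℂ) + t * Complex.I‖ := by
  have := Complex.re_le_norm ((x:ℂ) + t * Complex.I)
  simpa using this

lemma le_norm_im (x t : ℝ) : |t| ≤ ‖(x:ℂ) + t * Complex.I‖ := by
  have := Complex.abs_im_le_norm ((x:ℂ) + t * Complex.I)
  simpa using this

lemma Gamma_nat (t : ℝ) {x : ℝ} (hx : 0 < x) (n : ℕ) :
    ‖Complex.Gamma ((x + n : ℝ) + t * Complex.I)‖ ≤ (x + n + |t|)^n * ‖Complex.Gamma (x + t * Complex.I)‖ := by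
  induction n with
  | zero => simp
  | succ n ih =>
    have hz : ((x + n : ℝ) : ℂ) + t * Complex.I ≠ 0 := by
      intro h
      have := congrArg Complex.re h
      simp at this
      have : (0:ℝ) ≤ n := Nat.cast_nonneg n
      linarith
    have e : ((x + (n+1 : ℕ) : ℝ) : ℂ) + t * Complex.I = ((x + n : ℝ) : ℂ) + t * Complex.I + 1 := by push_cast; ring
    rw [e, Complex.Gamma_add_one _ hz, norm_mul, pow_succ']
    have h1 := norm_re_im_le (x+n) t (by positivity)
    have h2 : (x + n + |t|)^n ≤ (x + (n+1 : ℕ) + |t|)^n := by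
      gcongr; simp
    have h3 : x + n + |t| ≤ x + (n+1 : ℕ) + |t| := by
      gcongr; simp
    rw [mul_assoc]
    refine mul_le_mul (h1.trans h3) (ih.trans ?_) (norm_nonneg _) (by positivity)
    gcongr

lemma Q_norm (d : ℕ) (σ t : ℝ) : ‖Qfun d (σ + t * Complex.I)‖ =
    ‖Complex.Gamma ((((d:ℝ)-1)/2 + σ : ℝ) + t * Complex.I)‖ / ‖Complex.Gamma ((((d:ℝ)+1)/2 - σ : ℝ) + t * Complex.I)‖ := by
  unfold Qfun
  rw [norm_div]
  congr 1
  · congr 2; push_cast; ring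
  · rw [← RCLike.norm_conj, ← Complex.Gamma_conj]
    congr 2
    simp only [map_add, map_mul, map_sub, map_div₀, Complex.conj_ofReal, Complex.conj_I, map_natCast, map_one, map_ofNat]
    push_cast; ring

lemma Q_small (d : ℕ) (hd : 2 ≤ d) {σ : ℝ} (h0 : 0 < σ) (h1 : σ ≤ 1/2) (t : ℝ) :
    ‖Qfun d (σ + t * Complex.I)‖ ≤ 3 * ‖((((d:ℝ)+1)/2 - σ : ℝ):ℂ) + t * Complex.I‖ ^ (-(1-2*σ)) := by
  have hd' : (2:ℝ) ≤ d := by exact_mod_cast hd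
  have hx : 0 < ((d:ℝ)-1)/2 + σ := by linarith
  have k := Gamma_key t (x := ((d:ℝ)-1)/2 + σ) (θ := 1 - 2*σ) hx (by linarith) (by linarith)
  have e : ((d:ℝ)-1)/2 + σ + (1-2*σ) = ((d:ℝ)+1)/2 - σ := by ring
  rw [e] at k
  have hp : 0 < ((d:ℝ)+1)/2 - σ := by linarith
  have hg := norm_pos_iff.2 (Gne t _ hp)
  rw [Q_norm, div_le_iff₀ hg]
  refine k.trans ?_
  gcongr
  rw [div_le_iff₀ hx]
  linarith

lemma Q_int (d k : ℕ) (hd : 2 * k < d) (t : ℝ) :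
    ‖Qfun d ((k + 1/2 : ℝ) + t * Complex.I)‖ ≤ (d + 2*k + |t|)^(2*k) := by
  have hd' : (2:ℝ) * k < d := by exact_mod_cast hd
  have hx : 0 < (d:ℝ)/2 - k := by linarith
  have h := Gamma_nat t hx (2*k)
  have e1 : ((d:ℝ)-1)/2 + (k+1/2) = (d:ℝ)/2 - k + (2*k:ℕ) := by push_cast; ring
  have e2 : ((d:ℝ)+1)/2 - (k+1/2) = (d:ℝ)/2 - k := by ring
  have hg := norm_pos_iff.2 (Gne t _ hx)
  rw [Q_norm, e1, e2, div_le_iff₀ hg]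
  refine h.trans ?_
  have h5 : (d:ℝ)/2 - k + (2*k:ℕ) + |t| ≤ d + 2*k + |t| := by
    push_cast
    have : (0:ℝ) ≤ k := by positivity
    linarith
  exact mul_le_mul_of_nonneg_right (pow_le_pow_left₀ (by positivity) h5 _) (norm_nonneg _)

lemma Gamma_int (k : ℕ) (t : ℝ) :
    ‖Complex.Gamma ((k + 1/2 : ℝ) + t * Complex.I)‖ * Real.exp (π * |t| / 2) ≤ 3 * (k + 1/2 + |t|)^k := by
  have h := Gamma_nat t (x := 1/2) (by norm_num) k
  have h2 := Gamma_half t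
  rw [add_comm (1/2:ℝ)] at h
  calc _ ≤ ((k:ℝ)+1/2+|t|)^k * ‖Complex.Gamma ((1/2:ℝ) + t * Complex.I)‖ * Real.exp (π * |t| / 2) := by gcongr
    _ = ((k:ℝ)+1/2+|t|)^k * (‖Complex.Gamma ((1/2:ℝ) + t * Complex.I)‖ * Real.exp (π * |t| / 2)) := by ring
    _ ≤ ((k:ℝ)+1/2+|t|)^k * 3 := by gcongr
    _ = _ := by ring

lemma Gamma_small {σ : ℝ} (h0 : 0 < σ) (h1 : σ ≤ 1/2) (t : ℝ) :
    ‖Complex.Gamma (σ + t * Complex.I)‖ * Real.exp (π * |t| / 2) ≤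
      3 / (2*σ) * ‖((1/2:ℝ):ℂ) + t * Complex.I‖ ^ (-(1/2-σ)) := by
  have k := Gamma_key t (x := σ) (θ := 1/2 - σ) h0 (by linarith) (by linarith)
  have h2 := Gamma_half t
  have e : σ + (1/2 - σ) = 1/2 := by ring
  rw [e] at k
  calc _ ≤ 1/2/σ * ‖((1/2:ℝ):ℂ) + t * Complex.I‖ ^ (-(1/2-σ)) * ‖Complex.Gamma ((1/2:ℝ) + t * Complex.I)‖ * Real.exp (π * |t| / 2) := by gcongr
    _ = 1/2/σ * ‖((1/2:ℝ):ℂ) + t * Complex.I‖ ^ (-(1/2-σ)) * (‖Complex.Gamma ((1/2:ℝ) + t * Complex.I)‖ * Real.exp (π * |t| / 2)) := by ring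
    _ ≤ 1/2/σ * ‖((1/2:ℝ):ℂ) + t * Complex.I‖ ^ (-(1/2-σ)) * 3 := by gcongr
    _ = _ := by field_simp

lemma Gamma_strip (k : ℕ) {l : ℝ} (hl : 0 < l) : ∃ C : ℝ, 0 ≤ C ∧ ∀ σ ∈ Icc l (k+1/2), ∀ t : ℝ,
    ‖Complex.Gamma (σ + t * Complex.I)‖ * Real.exp (π * |t| / 2) ≤ C * (k + 1/2 + |t|)^k := by
  have hc : ContinuousOn (fun σ : ℝ => Real.Gamma σ / Real.Gamma (k+1/2)) (Icc l (k+1/2)) := by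
    apply ContinuousOn.div_const
    intro σ hσ
    refine (Real.differentiableAt_Gamma ?_).continuousAt.continuousWithinAt
    intro m h
    have : (0:ℝ) ≤ m := Nat.cast_nonneg m
    linarith [hσ.1]
  obtain ⟨C, hC⟩ := isCompact_Icc.exists_bound_of_continuousOn hc
  refine ⟨max C 0 * 3, by positivity, fun σ hσ t => ?_⟩
  have h1 := Gamma_mono t (hl.trans_le hσ.1) hσ.2
  have h2 := Gamma_int k t
  have h3 := ((le_abs_self _).trans (hC σ hσ)).trans (le_max_left C 0)
  calc _ ≤ (max C 0 * ‖Complex.Gamma ((k+1/2:ℝ) + t * Complex.I)‖) * Real.exp (π * |t| / 2) := by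
        gcongr
        refine h1.trans ?_
        gcongr
    _ = max C 0 * (‖Complex.Gamma ((k+1/2:ℝ) + t * Complex.I)‖ * Real.exp (π * |t| / 2)) := by ring
    _ ≤ max C 0 * (3 * (k+1/2+|t|)^k) := by gcongr
    _ = _ := by ring

lemma Q_strip (d k : ℕ) (hd2 : 2 ≤ d) (hd : 2 * k < d) : ∃ C : ℝ, 0 ≤ C ∧ ∀ σ ∈ Icc 0 ((k:ℝ)+1/2), ∀ t : ℝ,
    ‖Qfun d (σ + t * Complex.I)‖ ≤ C * (d + 2*k + |t|)^(2*k) := by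
  have hd' : (2:ℝ) * k < d := by exact_mod_cast hd
  have hd2' : (2:ℝ) ≤ d := by exact_mod_cast hd2
  have hcG : ∀ x : ℝ, 0 < x → ContinuousAt Real.Gamma x := by
    intro x hx
    refine (Real.differentiableAt_Gamma ?_).continuousAt
    intro m h
    have : (0:ℝ) ≤ m := Nat.cast_nonneg m
    linarith
  have hc : ContinuousOn (fun σ : ℝ => Real.Gamma (((d:ℝ)-1)/2 + σ) / Real.Gamma (((d:ℝ)-1)/2 + (k+1/2)) *
      (Real.Gamma (((d:ℝ)+1)/2 - (k+1/2)) / Real.Gamma (((d:ℝ)+1)/2 - σ))) (Icc 0 (k+1/2)) := by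
    intro σ hσ
    have p1 : 0 < ((d:ℝ)-1)/2 + σ := by linarith [hσ.1]
    have p2 : 0 < ((d:ℝ)+1)/2 - σ := by linarith [hσ.2]
    apply ContinuousAt.continuousWithinAt
    have c1 : ContinuousAt (fun σ : ℝ => Real.Gamma (((d:ℝ)-1)/2 + σ)) σ :=
      (hcG _ p1).comp (f := fun σ : ℝ => ((d:ℝ)-1)/2 + σ) (by fun_prop)
    have c2 : ContinuousAt (fun σ : ℝ => Real.Gamma (((d:ℝ)+1)/2 - σ)) σ :=
      (hcG _ p2).comp (f := fun σ : ℝ => ((d:ℝ)+1)/2 - σ) (by fun_prop)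
    exact (c1.div_const _).mul (continuousAt_const.div c2 (Real.Gamma_pos_of_pos p2).ne')
  obtain ⟨C, hC⟩ := isCompact_Icc.exists_bound_of_continuousOn hc
  refine ⟨max C 0, by positivity, fun σ hσ t => ?_⟩
  have p1 : 0 < ((d:ℝ)-1)/2 + σ := by linarith [hσ.1]
  have p2 : 0 < ((d:ℝ)+1)/2 - (k+1/2) := by linarith [hσ.2]
  have h1 := Gamma_mono t p1 (y := ((d:ℝ)-1)/2 + (k+1/2)) (by linarith [hσ.2])
  have h2 := Gamma_mono t p2 (y := ((d:ℝ)+1)/2 - σ) (by linarith [hσ.2])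
  have h3 := ((le_abs_self _).trans (hC σ hσ)).trans (le_max_left C 0)
  have h4 := Q_int d k hd t
  have p3 : 0 < ((d:ℝ)+1)/2 - σ := by linarith [hσ.2]
  have g1 := norm_pos_iff.2 (Gne t _ p3)
  have g2 := norm_pos_iff.2 (Gne t _ p2)
  rw [Q_norm] at h4 ⊢
  set A := ‖Complex.Gamma ((((d:ℝ)-1)/2 + σ : ℝ) + t * Complex.I)‖
  set B := ‖Complex.Gamma ((((d:ℝ)+1)/2 - σ : ℝ) + t * Complex.I)‖
  set A' := ‖Complex.Gamma ((((d:ℝ)-1)/2 + (k+1/2) : ℝ) + t * Complex.I)‖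
  set B' := ‖Complex.Gamma ((((d:ℝ)+1)/2 - (k+1/2) : ℝ) + t * Complex.I)‖
  set u := Real.Gamma (((d:ℝ)-1)/2 + σ) / Real.Gamma (((d:ℝ)-1)/2 + (k+1/2))
  set v := Real.Gamma (((d:ℝ)+1)/2 - (k+1/2)) / Real.Gamma (((d:ℝ)+1)/2 - σ)
  have hu : 0 ≤ u := div_nonneg (Real.Gamma_pos_of_pos p1).le (Real.Gamma_pos_of_pos (by linarith)).le
  have h5 : 1/B ≤ v / B' := by
    rw [div_le_div_iff₀ g1 g2]; linarith
  calc A / B = A * (1/B) := by ring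
    _ ≤ (u * A') * (v/B') := by
        refine mul_le_mul h1 h5 (by positivity) (by positivity)
    _ = (u * v) * (A'/B') := by ring
    _ ≤ max C 0 * (d + 2*k + |t|)^(2*k) := by
        refine mul_le_mul h3 h4 (by positivity) (by positivity)

/-- test functions on the positive half line -/
def Nice (f : ℝ → ℂ) : Prop :=
  ContDiff ℝ (⊤ : ℕ∞) f ∧ HasCompactSupport f ∧ tsupport f ⊆ Ioi (0:ℝ)

lemma Nice.cont_cpow {f : ℝ → ℂ} (hf : Nice f) (s : ℂ) : Continuous (fun t : ℝ => (t:ℂ)^s * f t) := by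
  apply continuous_of_tsupport
  intro x hx
  have hx' : x ∈ tsupport f := (tsupport_mul_subset_right (f := fun t : ℝ => (t:ℂ)^s)) hx
  have h0 : 0 < x := hf.2.2 hx'
  have := Complex.continuousAt_ofReal_cpow_const x s (Or.inr h0.ne')
  exact this.mul hf.1.continuous.continuousAt

lemma Nice.supp_cpow {f : ℝ → ℂ} (hf : Nice f) (s : ℂ) : HasCompactSupport (fun t : ℝ => (t:ℂ)^s * f t) :=
  hf.2.1.mul_left

lemma Nice.integrable {f : ℝ → ℂ} (hf : Nice f) (s : ℂ) : Integrable (fun t : ℝ => (t:ℂ)^s * f t) :=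
  (hf.cont_cpow s).integrable_of_hasCompactSupport (hf.supp_cpow s)

lemma Nice.zero {f : ℝ → ℂ} (hf : Nice f) {x : ℝ} (hx : x ≤ 0) : f x = 0 := by
  by_contra h
  have := hf.2.2 (subset_tsupport f h)
  exact absurd this (not_lt.2 hx)

def Dop (f : ℝ → ℂ) : ℝ → ℂ := fun t => -((t:ℂ) * deriv f t)

lemma Nice.D {f : ℝ → ℂ} (hf : Nice f) : Nice (Dop f) := by
  have hs : tsupport (Dop f) ⊆ tsupport f := by
    have h1 : tsupport (Dop f) ⊆ tsupport (deriv f) := by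
      apply closure_mono
      intro x hx h
      apply hx
      simp [Dop, h]
    exact h1.trans (tsupport_deriv_subset (𝕜 := ℝ))
  refine ⟨?_, ?_, hs.trans hf.2.2⟩
  · have h1 : ContDiff ℝ (⊤ : ℕ∞) (deriv f) := by
      have := hf.1
      exact (contDiff_infty_iff_deriv.1 this).2
    exact (Complex.ofRealCLM.contDiff.mul h1).neg
  · exact hf.2.1.of_isClosed_subset (isClosed_tsupport _) hs

lemma Nice.mellin_D {f : ℝ → ℂ} (hf : Nice f) (s : ℂ) : mellin (Dop f) s = s * mellin f s := by
  have hd : ∀ x ∈ Ioi (0:ℝ), HasDerivAt (fun t : ℝ => (t:ℂ)^s * f t)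
      (s * ((x:ℂ)^(s-1) * f x) - (x:ℂ)^(s-1) * Dop f x) x := by
    intro x hx
    have hx0 : (x:ℝ) ≠ 0 := (ne_of_gt hx)
    have hxc : (x:ℂ) ≠ 0 := by exact_mod_cast hx0
    have h2 : HasDerivAt f (deriv f x) x :=
      (hf.1.differentiable (by simp)).differentiableAt.hasDerivAt
    have h1 : HasDerivAt (fun t : ℝ => (t:ℂ)^s) (s * (x:ℂ)^(s-1)) x := by
      have := (hasDerivAt_id (x:ℂ)).cpow_const (c := s) (Or.inl (by simpa using hx))
      have := this.comp_ofReal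
      simpa using this
    refine (h1.mul h2).congr_deriv ?_
    have : (x:ℂ)^s = (x:ℂ)^(s-1) * x := by
      conv_lhs => rw [show s = (s-1) + 1 by ring, Complex.cpow_add _ _ hxc, Complex.cpow_one]
    rw [this]
    simp only [Dop]
    ring
  have hint1 := (hf.integrable (s-1)).integrableOn (s := Ioi (0:ℝ))
  have hint2 := (hf.D.integrable (s-1)).integrableOn (s := Ioi (0:ℝ))
  have ht : Filter.Tendsto (fun t : ℝ => (t:ℂ)^s * f t) Filter.atTop (nhds 0) := by
    apply ((hf.supp_cpow s).is_zero_at_infty).mono_left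
    exact atTop_le_cocompact
  have h := integral_Ioi_of_hasDerivAt_of_tendsto (hf.cont_cpow s).continuousAt.continuousWithinAt hd
    ((hint1.const_mul s).sub hint2) ht
  rw [hf.zero le_rfl, mul_zero, sub_zero, integral_sub (hint1.const_mul s) hint2, integral_const_mul] at h
  unfold mellin
  simp only [smul_eq_mul]
  exact (sub_eq_zero.1 h).symm

lemma Nice.mellin_bdd {f : ℝ → ℂ} (hf : Nice f) (l u : ℝ) : ∃ C : ℝ, ∀ s : ℂ, l ≤ s.re → s.re ≤ u → ‖mellin f s‖ ≤ C := by
  have hint1 := (hf.integrable (l-1)).norm.integrableOn (s := Ioi (0:ℝ))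
  have hint2 := (hf.integrable (u-1)).norm.integrableOn (s := Ioi (0:ℝ))
  refine ⟨∫ t in Ioi (0:ℝ), (‖(t:ℂ)^((l:ℂ)-1) * f t‖ + ‖(t:ℂ)^((u:ℂ)-1) * f t‖), fun s h1 h2 => ?_⟩
  unfold mellin
  refine norm_integral_le_of_norm_le (hint1.add hint2) ?_
  refine (ae_restrict_iff' measurableSet_Ioi).2 (Filter.Eventually.of_forall fun t ht => ?_)
  have ht' : 0 < t := ht
  simp only [smul_eq_mul, norm_mul, Complex.norm_cpow_eq_rpow_re_of_pos ht', Complex.sub_re, Complex.ofReal_re, Complex.one_re]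
  rw [← add_mul]
  apply mul_le_mul_of_nonneg_right _ (norm_nonneg _)
  have p1 : 0 ≤ t^(l-1) := by positivity
  have p2 : 0 ≤ t^(u-1) := by positivity
  rcases le_total 1 t with h | h
  · have := Real.rpow_le_rpow_of_exponent_le h (show s.re - 1 ≤ u - 1 by linarith)
    linarith
  · have := Real.rpow_le_rpow_of_exponent_ge ht' h (show l - 1 ≤ s.re - 1 by linarith)
    linarith

lemma mellin_decay (N : ℕ) (l u : ℝ) : ∀ f : ℝ → ℂ, Nice f → ∃ C : ℝ, 0 ≤ C ∧ ∀ s : ℂ, l ≤ s.re → s.re ≤ u →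
    ‖mellin f s‖ * (1 + |s.im|)^N ≤ C := by
  induction N with
  | zero =>
    intro f hf
    obtain ⟨C, hC⟩ := hf.mellin_bdd l u
    exact ⟨max C 0, le_max_right _ _, fun s h1 h2 => by simpa using Or.inl (hC s h1 h2)⟩
  | succ N ih =>
    intro f hf
    obtain ⟨C1, h01, hC1⟩ := ih f hf
    obtain ⟨C2, h02, hC2⟩ := ih _ hf.D
    refine ⟨C1 + C2, by positivity, fun s h1 h2 => ?_⟩
    have a1 := hC1 s h1 h2
    have a2 := hC2 s h1 h2
    rw [hf.mellin_D, norm_mul] at a2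
    have a3 := Complex.abs_im_le_norm s
    calc ‖mellin f s‖ * (1 + |s.im|)^(N+1) = ‖mellin f s‖ * (1 + |s.im|)^N + |s.im| * (‖mellin f s‖ * (1 + |s.im|)^N) := by ring
      _ ≤ ‖mellin f s‖ * (1 + |s.im|)^N + ‖s‖ * (‖mellin f s‖ * (1 + |s.im|)^N) := by gcongr
      _ ≤ C1 + C2 := by
        refine add_le_add a1 (le_trans (le_of_eq ?_) a2)
        ring

lemma Nice.mellin_diff {f : ℝ → ℂ} (hf : Nice f) : Differentiable ℂ (mellin f) := by
  intro s
  refine mellin_differentiableAt_of_isBigO_rpow (a := s.re + 1) (b := s.re - 1) ?_ ?_ (by linarith) ?_ (by linarith)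
  · exact hf.1.continuous.locallyIntegrable.locallyIntegrableOn _
  · have : f =ᶠ[Filter.atTop] (fun _ => 0) :=
      (hasCompactSupport_iff_eventuallyEq.1 hf.2.1).filter_mono
        (by rw [Filter.coclosedCompact_eq_cocompact]; exact atTop_le_cocompact)
    exact this.trans_isBigO (Asymptotics.isBigO_zero _ _)
  · have h0 : (0:ℝ) ∉ tsupport f := fun h => lt_irrefl (0:ℝ) (hf.2.2 h)
    have : f =ᶠ[nhdsWithin 0 (Ioi 0)] (fun _ => 0) :=
      (notMem_tsupport_iff_eventuallyEq.1 h0).filter_mono nhdsWithin_le_nhds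
    exact this.trans_isBigO (Asymptotics.isBigO_zero _ _)

/-- Fubini step -/
lemma swap_mellin {W : ℝ → ℂ} (hW : Nice W) {f : ℝ → ℂ} (hf : Integrable f) (c : ℝ) (w : ℝ → ℂ) (hw : Continuous w)
    (hwr : ∀ t, (w t).re = c) :
    ∫ ξ in Ioi (0:ℝ), (∫ t, f t * (ξ:ℂ)^(w t)) * W ξ = ∫ t, f t * mellin W (w t + 1) := by
  have h1 : ∫ ξ in Ioi (0:ℝ), (∫ t, f t * (ξ:ℂ)^(w t)) * W ξ = ∫ ξ in Ioi (0:ℝ), (∫ t, f t * (ξ:ℂ)^(w t) * W ξ) := by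
    congr 1; ext ξ; rw [← integral_mul_const]
  rw [h1, integral_integral_swap]
  · congr 1; ext t
    unfold mellin
    rw [← integral_const_mul]
    congr 1; ext ξ
    simp; ring
  · have hg := ((hW.integrable c).integrableOn (s := Ioi (0:ℝ))).norm
    have hprod := hg.mul_prod hf.norm
    refine hprod.mono ?_ ?_
    · refine AEStronglyMeasurable.mul (AEStronglyMeasurable.mul ?_ ?_) ?_
      · exact hf.aestronglyMeasurable.comp_snd
      · apply Measurable.aestronglyMeasurable
        exact (Complex.measurable_ofReal.comp measurable_fst).pow (hw.measurable.comp measurable_snd)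
      · exact (hW.1.continuous.comp continuous_fst).aestronglyMeasurable
    · have : ∀ᵐ p : ℝ × ℝ ∂((volume.restrict (Ioi (0:ℝ))).prod volume), p.1 ∈ Ioi (0:ℝ) :=
        Measure.quasiMeasurePreserving_fst.ae (ae_restrict_mem measurableSet_Ioi)
      filter_upwards [this] with p hp
      have hp' : 0 < p.1 := hp
      simp only [Function.uncurry, norm_mul, Complex.norm_cpow_eq_rpow_re_of_pos hp', hwr, Complex.ofReal_re, norm_norm]
      rw [Real.norm_of_nonneg (by positivity)]
      apply le_of_eq; ring

lemma shift_line (F : ℂ → ℂ) {l u : ℝ} (hlu : l ≤ u) (hd : DifferentiableOn ℂ F {s | s.re ∈ Icc l u}) (C : ℝ)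
    (hC : ∀ σ ∈ Icc l u, ∀ t : ℝ, ‖F (σ + t * Complex.I)‖ ≤ C * (1 + t^2)⁻¹) :
    ∫ t : ℝ, F (l + t * Complex.I) = ∫ t : ℝ, F (u + t * Complex.I) := by
  have hInt0 : ∀ σ ∈ Icc l u, Integrable (fun t : ℝ => F (σ + t * Complex.I)) := by
    intro σ hσ
    refine (integrable_inv_one_add_sq.const_mul C).mono' ?_ (Filter.Eventually.of_forall (hC σ hσ))
    apply Continuous.aestronglyMeasurable
    exact hd.continuousOn.comp_continuous (by fun_prop) (fun t => by simpa using hσ)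
  have hrect : ∀ R : ℝ, (∫ x : ℝ in l..u, F (x + (-R:ℝ) * Complex.I)) - (∫ x : ℝ in l..u, F (x + R * Complex.I)) +
      Complex.I • (∫ y : ℝ in (-R)..R, F (u + y * Complex.I)) -
      Complex.I • (∫ y : ℝ in (-R)..R, F (l + y * Complex.I)) = 0 := by
    intro R
    have := Complex.integral_boundary_rect_eq_zero_of_differentiableOn F ⟨l, -R⟩ ⟨u, R⟩ ?_
    · simpa using this
    · refine hd.mono ?_
      rintro s ⟨h1, -⟩
      simp only [uIcc_of_le hlu] at h1
      exact h1
  have tl := intervalIntegral_tendsto_integral (hInt0 l (left_mem_Icc.2 hlu)) Filter.tendsto_neg_atTop_atBot Filter.tendsto_id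
  have tu := intervalIntegral_tendsto_integral (hInt0 u (right_mem_Icc.2 hlu)) Filter.tendsto_neg_atTop_atBot Filter.tendsto_id
  have hbnd : ∀ R : ℝ, ‖∫ x : ℝ in l..u, F (x + R * Complex.I)‖ ≤ C * (1+R^2)⁻¹ * |u - l| := by
    intro R
    apply intervalIntegral.norm_integral_le_of_norm_le_const
    intro x hx
    rw [uIoc_of_le hlu] at hx
    exact hC x (Ioc_subset_Icc_self hx) R
  have hz : Filter.Tendsto (fun R : ℝ => C * (1+R^2)⁻¹ * |u - l|) Filter.atTop (nhds 0) := by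
    have : Filter.Tendsto (fun R : ℝ => (1+R^2)⁻¹) Filter.atTop (nhds 0) := by
      apply Filter.Tendsto.inv_tendsto_atTop
      exact Filter.tendsto_atTop_add_const_left _ _ (Filter.tendsto_pow_atTop (by norm_num))
    simpa using (this.const_mul C).mul_const |u-l|
  have t1 : Filter.Tendsto (fun R : ℝ => ∫ x : ℝ in l..u, F (x + R * Complex.I)) Filter.atTop (nhds 0) :=
    squeeze_zero_norm hbnd hz
  have t2 : Filter.Tendsto (fun R : ℝ => ∫ x : ℝ in l..u, F (x + (-R:ℝ) * Complex.I)) Filter.atTop (nhds 0) :=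
    squeeze_zero_norm (fun R => by simpa using hbnd (-R)) hz
  have tot := ((t2.sub t1).add (tu.const_smul Complex.I)).sub (tl.const_smul Complex.I)
  have h0 := tendsto_nhds_unique tot (tendsto_const_nhds.congr (fun R => (hrect R).symm))
  simp only [smul_eq_mul, sub_zero, zero_add] at h0
  have := mul_left_cancel₀ Complex.I_ne_zero (sub_eq_zero.1 h0)
  exact this.symm

/-- the integrand without the Mellin transforms -/
def F0 (d : ℕ) (ρ e A : ℝ) (s : ℂ) : ℂ :=
  (A:ℂ) ^ ((1:ℂ) - ρ * Complex.I - s) * Qfun d s * Complex.Gamma (s + 3 * (ρ * Complex.I)) *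
    Complex.exp (e * Complex.I * (π:ℂ) * (s + 3 * (ρ * Complex.I)) / 2)

def F1 (W : ℝ → ℂ) (d : ℕ) (ρ e A : ℝ) (s : ℂ) : ℂ :=
  F0 d ρ e A s * mellin W (2 - ρ * Complex.I - s) * mellin W (2 - ρ * Complex.I - s)

lemma diffGamma {s : ℂ} (hs : 0 < s.re) : DifferentiableAt ℂ Complex.Gamma s := by
  apply Complex.differentiableAt_Gamma
  intro m h
  rw [h] at hs
  simp at hs
  have : (0:ℝ) ≤ m := Nat.cast_nonneg m
  linarith

lemma F0_diff (d : ℕ) (hd : 2 ≤ d) (ρ e : ℝ) {A : ℝ} (hA : 0 < A) {s : ℂ} (hs : 0 < s.re) : DifferentiableAt ℂ (F0 d ρ e A) s := by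
  have hd' : (2:ℝ) ≤ d := by exact_mod_cast hd
  have hA' : (A:ℂ) ≠ 0 := by exact_mod_cast hA.ne'
  unfold F0
  refine DifferentiableAt.mul (DifferentiableAt.mul (DifferentiableAt.mul ?_ ?_) ?_) ?_
  · exact DifferentiableAt.const_cpow (by fun_prop) (Or.inl hA')
  · unfold Qfun
    simp only [div_eq_mul_inv (Complex.Gamma _)]
    refine DifferentiableAt.mul ?_ ?_
    · refine DifferentiableAt.comp s (g := Complex.Gamma) (diffGamma ?_) (by fun_prop)
      have : (((d:ℂ)-1)/2 + s).re = ((d:ℝ)-1)/2 + s.re := by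
        simp
      rw [this]; linarith
    · exact DifferentiableAt.comp s (g := fun s => (Complex.Gamma s)⁻¹) (Complex.differentiable_one_div_Gamma _) (by fun_prop)
  · refine DifferentiableAt.comp s (g := Complex.Gamma) (diffGamma ?_) (by fun_prop)
    simpa using hs
  · fun_prop

lemma F1_diff {W : ℝ → ℂ} (hW : Nice W) (d : ℕ) (hd : 2 ≤ d) (ρ e : ℝ) {A : ℝ} (hA : 0 < A) {s : ℂ} (hs : 0 < s.re) :
    DifferentiableAt ℂ (F1 W d ρ e A) s := by
  have hm : DifferentiableAt ℂ (fun s : ℂ => mellin W (2 - ρ * Complex.I - s)) s :=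
    (hW.mellin_diff _).comp s (by fun_prop)
  exact ((F0_diff d hd ρ e hA hs).mul hm).mul hm

lemma F0_norm (d : ℕ) (ρ : ℝ) {e A : ℝ} (he : |e| ≤ 1) (hA : 0 < A) (σ t : ℝ) :
    ‖F0 d ρ e A (σ + t * Complex.I)‖ ≤ A^(1-σ) * ‖Qfun d (σ + t * Complex.I)‖ *
      (‖Complex.Gamma (σ + (t + 3*ρ : ℝ) * Complex.I)‖ * Real.exp (π * |t+3*ρ| / 2)) := by
  unfold F0
  rw [norm_mul, norm_mul, norm_mul, Complex.norm_cpow_eq_rpow_re_of_pos hA, Complex.norm_exp, mul_assoc]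
  have e1 : ((1:ℂ) - ρ * Complex.I - (σ + t * Complex.I)).re = 1 - σ := by simp
  have e2 : (σ:ℂ) + t * Complex.I + 3 * (ρ * Complex.I) = σ + (t + 3*ρ : ℝ) * Complex.I := by push_cast; ring
  rw [e1, e2]
  gcongr
  have e3 : (e:ℂ) * Complex.I * π * (σ + (t + 3*ρ : ℝ) * Complex.I) / 2 = ((-(e * π * (t+3*ρ) / 2) : ℝ) : ℂ) + ((e * π * σ / 2 : ℝ):ℂ) * Complex.I := by
    push_cast
    linear_combination ((e:ℂ) * π * (t+3*ρ)/2) * Complex.I_sq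
  rw [e3]
  simp only [Complex.add_re, Complex.ofReal_re, Complex.mul_re, Complex.I_re, Complex.I_im, Complex.ofReal_im, mul_zero, zero_mul, sub_zero, add_zero]
  have : |e * (t+3*ρ)| ≤ |t+3*ρ| := by
    rw [abs_mul]
    exact mul_le_of_le_one_left (abs_nonneg _) he
  have h2 := neg_le_of_abs_le this
  have := Real.pi_pos
  nlinarith

lemma F0_integrable (d : ℕ) (hd : 2 ≤ d) (ρ : ℝ) {e A : ℝ} (he : |e| ≤ 1) (hA : 0 < A) :
    Integrable (fun t : ℝ => F0 d ρ e A ((1/12:ℝ) + t * Complex.I)) := by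
  have hd' : (2:ℝ) ≤ d := by exact_mod_cast hd
  have hI : Integrable (fun t : ℝ => (1 + ‖t‖)^(-(5/4:ℝ))) := integrable_one_add_norm (by simp; norm_num)
  set K := A^(1-1/12:ℝ) * (3 * (2:ℝ)^(5/6:ℝ)) * (3 / (2*(1/12)) * (3 + 6*|ρ|)^(5/12:ℝ)) with hK
  refine (hI.const_mul K).mono' ?_ ?_
  · apply Continuous.aestronglyMeasurable
    rw [continuous_iff_continuousAt]
    intro t
    refine ContinuousAt.comp (f := fun t : ℝ => (((1/12:ℝ):ℂ) + t * Complex.I)) (F0_diff d hd ρ e hA ?_).continuousAt (by fun_prop)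
    simp
  · refine Filter.Eventually.of_forall fun t => ?_
    refine (F0_norm d ρ he hA (1/12) t).trans ?_
    have q := Q_small d hd (σ := 1/12) (by norm_num) (by norm_num) t
    have g := Gamma_small (σ := 1/12) (by norm_num) (by norm_num) (t+3*ρ)
    have hp : 0 < 1 + |t| := by positivity
    have q2 : ‖((((d:ℝ)+1)/2 - 1/12 : ℝ):ℂ) + t * Complex.I‖ ^ (-(1-2*(1/12)):ℝ) ≤ (2:ℝ)^(5/6:ℝ) * (1+|t|)^(-(5/6):ℝ) := by
      have a1 := le_norm_re (((d:ℝ)+1)/2 - 1/12) t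
      have a2 := le_norm_im (((d:ℝ)+1)/2 - 1/12) t
      have a3 : (1+|t|)/2 ≤ ‖((((d:ℝ)+1)/2 - 1/12 : ℝ):ℂ) + t * Complex.I‖ := by linarith
      have := Real.rpow_le_rpow_of_nonpos (by positivity) a3 (show (-(1-2*(1/12)):ℝ) ≤ 0 by norm_num)
      refine this.trans (le_of_eq ?_)
      rw [Real.div_rpow hp.le (by norm_num), show (-(1-2*(1/12)):ℝ) = -(5/6) by norm_num, Real.rpow_neg (by norm_num : (0:ℝ) ≤ 2), div_inv_eq_mul, mul_comm]
    have g2 : ‖((1/2:ℝ):ℂ) + (t+3*ρ:ℝ) * Complex.I‖ ^ (-(1/2-1/12):ℝ) ≤ (3+6*|ρ|)^(5/12:ℝ) * (1+|t|)^(-(5/12):ℝ) := by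
      have a1 := le_norm_re (1/2) (t+3*ρ)
      have a2 := le_norm_im (1/2) (t+3*ρ)
      set n := ‖((1/2:ℝ):ℂ) + (t+3*ρ:ℝ) * Complex.I‖
      have a4 : |t| ≤ |t+3*ρ| + 3*|ρ| := by
        have := abs_sub (t+3*ρ) (3*ρ)
        rw [abs_mul, show t + 3*ρ - 3*ρ = t by ring] at this
        simpa using this
      have a3 : (1+|t|)/(3+6*|ρ|) ≤ n := by
        rw [div_le_iff₀ (by positivity)]
        nlinarith [abs_nonneg ρ]
      have := Real.rpow_le_rpow_of_nonpos (by positivity) a3 (show (-(1/2-1/12):ℝ) ≤ 0 by norm_num)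
      refine this.trans (le_of_eq ?_)
      rw [Real.div_rpow hp.le (by positivity), show (-(1/2-1/12):ℝ) = -(5/12) by norm_num, Real.rpow_neg (by positivity : (0:ℝ) ≤ 3+6*|ρ|), div_inv_eq_mul, mul_comm]
    have e1 : (1+‖t‖)^(-(5/4):ℝ) = (1+|t|)^(-(5/6):ℝ) * (1+|t|)^(-(5/12):ℝ) := by
      rw [← Real.rpow_add hp, Real.norm_eq_abs]; norm_num
    rw [e1, hK]
    calc _ ≤ A^(1-1/12:ℝ) * (3 * ((2:ℝ)^(5/6:ℝ) * (1+|t|)^(-(5/6):ℝ))) * (3 / (2*(1/12)) * ((3+6*|ρ|)^(5/12:ℝ) * (1+|t|)^(-(5/12):ℝ))) := by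
          refine mul_le_mul (mul_le_mul_of_nonneg_left (q.trans ?_) (by positivity)) (g.trans ?_) (by positivity) (by positivity)
          · gcongr
          · gcongr
      _ = _ := by ring

lemma sign_mul_pos {x : ℝ} (hx : 0 < x) (y : ℝ) : Real.sign (x*y) = Real.sign y := by
  rcases lt_trichotomy y 0 with h | h | h
  · rw [Real.sign_of_neg h, Real.sign_of_neg (mul_neg_of_pos_of_neg hx h)]
  · simp [h]
  · rw [Real.sign_of_pos h, Real.sign_of_pos (mul_pos hx h)]

lemma sign_abs_le (y : ℝ) : |Real.sign y| ≤ 1 := by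
  rcases Real.sign_apply_eq y with h | h | h <;> simp [h]

lemma Ktilde_eq {W : ℝ → ℂ} (hW : Nice W) (d : ℕ) (hd : 2 ≤ d) (ρ Ξ : ℝ) (hΞ : 1 < |Ξ|) :
    Ktilde W d (ρ * Complex.I) Ξ 0 0 = (1 / ((|Ξ| : ℝ) : ℂ)) *
      ((((Real.sign Ξ : ℂ) * Complex.I) ^ d / (4 * (Real.pi : ℂ) ^ 2)) * (1 / (2 * (Real.pi : ℂ))) *
      ∫ t : ℝ, F1 W d ρ (Real.sign Ξ) (8 * π^3 * |Ξ|) ((1/12:ℝ) + t * Complex.I)) := by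
  have hA : 0 < 8 * π^3 * |Ξ| := by positivity
  set A := 8 * π^3 * |Ξ| with hAdef
  set c := (((Real.sign Ξ : ℂ) * Complex.I) ^ d / (4 * (Real.pi : ℂ) ^ 2)) * (1 / (2 * (Real.pi : ℂ))) with hc
  have hf := F0_integrable d hd ρ (sign_abs_le Ξ) hA
  set f := fun t : ℝ => F0 d ρ (Real.sign Ξ) A ((1/12:ℝ) + t * Complex.I) with hfdef
  set w : ℝ → ℂ := fun t => (1:ℂ) - ρ * Complex.I - ((1/12:ℝ) + t * Complex.I) with hw
  have hwc : Continuous w := by fun_prop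
  have hwr : ∀ t, (w t).re = 11/12 := by intro t; simp [hw]; norm_num
  have hK : ∀ ξ η : ℝ, 0 < ξ → 0 < η → Kw4 (ξ * η * Ξ) d (ρ * Complex.I) =
      c * ∫ t, f t * (ξ:ℂ)^(w t) * (η:ℂ)^(w t) := by
    intro ξ η hξ hη
    unfold Kw4
    rw [sign_mul_pos (mul_pos hξ hη)]
    congr 2
    ext t
    have e1 : |8 * π^3 * (ξ * η * Ξ)| = A * ξ * η := by
      rw [hAdef, abs_mul, abs_mul, abs_mul, abs_mul ξ η, abs_of_pos hξ, abs_of_pos hη, abs_of_pos (by positivity : (0:ℝ) < 8), abs_of_pos (by positivity : 0 < π^3)]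
      ring
    rw [e1]
    have e2 : ((A * ξ * η : ℝ) : ℂ)^(w t) = (A:ℂ)^(w t) * (ξ:ℂ)^(w t) * (η:ℂ)^(w t) := by
      rw [Complex.ofReal_mul, Complex.mul_cpow_ofReal_nonneg (by positivity) hη.le, Complex.ofReal_mul, Complex.mul_cpow_ofReal_nonneg hA.le hξ.le]
    have e3 : (1:ℂ) - ρ * Complex.I - ((1/12:ℂ) + t * Complex.I) = w t := by
      simp [hw]
    have e4 : (1/12:ℂ) + t * Complex.I = ((1/12:ℝ):ℂ) + t * Complex.I := by simp
    rw [e3, e2, e4, hfdef]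
    simp only [F0]
    ring
  obtain ⟨CM, hCM⟩ := hW.mellin_bdd (11/12+1) (11/12+1)
  have hMc : Continuous (fun t => mellin W (w t + 1)) := hW.mellin_diff.continuous.comp (by fun_prop)
  have hMb : ∀ t, ‖mellin W (w t + 1)‖ ≤ CM := by
    intro t
    apply hCM <;> simp [hwr]
  have inner : ∀ ξ ∈ Ioi (0:ℝ), ∫ η in Ioi (0:ℝ), Kw4 (ξ * η * Ξ) d (ρ * Complex.I) * eFn (ξ * 0 + η * 0) * W ξ * W η =
      c * ((∫ t, (f t * mellin W (w t + 1)) * (ξ:ℂ)^(w t)) * W ξ) := by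
    intro ξ hξ
    have hξ' : 0 < ξ := hξ
    have hξc : (ξ:ℂ) ≠ 0 := by exact_mod_cast hξ'.ne'
    have hf' : Integrable (fun t => f t * (ξ:ℂ)^(w t)) := by
      refine hf.mul_bdd (c := ξ^(11/12:ℝ)) ?_ (Filter.Eventually.of_forall fun t => ?_)
      · apply Continuous.aestronglyMeasurable
        exact hwc.const_cpow (Or.inl hξc)
      · rw [Complex.norm_cpow_eq_rpow_re_of_pos hξ', hwr]
    have := swap_mellin hW hf' (11/12) w hwc hwr
    calc _ = ∫ η in Ioi (0:ℝ), (c * W ξ) * ((∫ t, f t * (ξ:ℂ)^(w t) * (η:ℂ)^(w t)) * W η) := by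
          refine setIntegral_congr_fun measurableSet_Ioi fun η hη => ?_
          rw [hK ξ η hξ hη]
          simp [eFn]
          ring
      _ = (c * W ξ) * ∫ t, f t * (ξ:ℂ)^(w t) * mellin W (w t + 1) := by
          rw [integral_const_mul, this]
      _ = _ := by
          rw [mul_assoc, mul_comm (W ξ)]
          congr 3
          ext t; ring
  unfold Ktilde
  congr 1
  rw [setIntegral_congr_fun measurableSet_Ioi inner, integral_const_mul]
  congr 1
  have hf2 : Integrable (fun t => f t * mellin W (w t + 1)) :=
    hf.mul_bdd hMc.aestronglyMeasurable (Filter.Eventually.of_forall hMb)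
  rw [swap_mellin hW hf2 (11/12) w hwc hwr]
  congr 1
  ext t
  have : w t + 1 = 2 - ρ * Complex.I - ((1/12:ℝ) + t * Complex.I) := by simp only [hw]; ring
  simp only [F1, hfdef, this]

lemma prod_bound (k : ℕ) {X m q g a b C : ℝ} (hX : 1 ≤ X) (hm : 0 ≤ m) (hg0 : 0 ≤ g) (ha : 0 ≤ a) (hb : 0 ≤ b)
    (hmX : m * X^(2*k+1) ≤ C) (hq : q ≤ a * X^(2*k)) (hg : g ≤ b * X^k) :
    q * g * m * m ≤ a * b * C^2 * (X^2)⁻¹ := by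
  have hX0 : 0 < X := by linarith
  rw [← div_eq_mul_inv, le_div_iff₀ (by positivity)]
  have h1 : (m * X^(2*k+1))^2 ≤ C^2 := pow_le_pow_left₀ (by positivity) hmX 2
  have h2 : X^(3*k+2) ≤ X^(4*k+2) := pow_le_pow_right₀ hX (by omega)
  calc q * g * m * m * X^2 ≤ (a * X^(2*k)) * (b * X^k) * m * m * X^2 := by gcongr
    _ = a * b * (m^2 * X^(3*k+2)) := by ring
    _ ≤ a * b * (m^2 * X^(4*k+2)) := by gcongr
    _ = a * b * (m * X^(2*k+1))^2 := by ring
    _ ≤ a * b * C^2 := by gcongr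

lemma poly1 (p t ρ : ℝ) (hp : 0 ≤ p) : p + |t| ≤ (p + 1 + |ρ|) * (1 + |t+ρ|) := by
  have h : |t| ≤ |t+ρ| + |ρ| := by
    have := abs_sub (t+ρ) ρ
    rwa [add_sub_cancel_right] at this
  nlinarith [abs_nonneg ρ, abs_nonneg (t+ρ), mul_nonneg hp (abs_nonneg (t+ρ)), mul_nonneg (abs_nonneg ρ) (abs_nonneg (t+ρ))]

lemma poly2 (p t ρ : ℝ) (hp : 0 ≤ p) : p + |t+3*ρ| ≤ (p + 1 + 2*|ρ|) * (1 + |t+ρ|) := by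
  have h : |t+3*ρ| ≤ |t+ρ| + 2*|ρ| := by
    have := abs_add_le (t+ρ) (2*ρ)
    rw [abs_mul, show t + ρ + 2*ρ = t+3*ρ by ring] at this
    simpa using this
  nlinarith [abs_nonneg ρ, abs_nonneg (t+ρ), mul_nonneg hp (abs_nonneg (t+ρ)), mul_nonneg (abs_nonneg ρ) (abs_nonneg (t+ρ))]

lemma mellin_line {W : ℝ → ℂ} (hW : Nice W) (N : ℕ) (l u : ℝ) : ∃ C : ℝ, 0 ≤ C ∧ ∀ σ ∈ Icc l u, ∀ t ρ : ℝ,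
    ‖mellin W (2 - ρ * Complex.I - (σ + t * Complex.I))‖ * (1 + |t+ρ|)^N ≤ C := by
  obtain ⟨C, h0, hC⟩ := mellin_decay N (2-u) (2-l) W hW
  refine ⟨C, h0, fun σ hσ t ρ => ?_⟩
  have := hC (2 - ρ * Complex.I - (σ + t * Complex.I)) (by simp; linarith [hσ.2]) (by simp; linarith [hσ.1])
  have e : (2 - ρ * Complex.I - (σ + t * Complex.I)).im = -(t+ρ) := by simp; ring
  rwa [e, abs_neg] at this

lemma F1_norm (W : ℝ → ℂ) (d : ℕ) (ρ : ℝ) {e A : ℝ} (he : |e| ≤ 1) (hA : 0 < A) (σ t : ℝ) :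
    ‖F1 W d ρ e A (σ + t * Complex.I)‖ ≤ A^(1-σ) * (‖Qfun d (σ + t * Complex.I)‖ *
      (‖Complex.Gamma (σ + (t + 3*ρ : ℝ) * Complex.I)‖ * Real.exp (π * |t+3*ρ| / 2)) *
      ‖mellin W (2 - ρ * Complex.I - (σ + t * Complex.I))‖ * ‖mellin W (2 - ρ * Complex.I - (σ + t * Complex.I))‖) := by
  unfold F1
  rw [norm_mul, norm_mul]
  have := F0_norm d ρ he hA σ t
  set m := ‖mellin W (2 - ρ * Complex.I - (σ + t * Complex.I))‖
  calc _ ≤ (A^(1-σ) * ‖Qfun d (σ + t * Complex.I)‖ *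
      (‖Complex.Gamma (σ + (t + 3*ρ : ℝ) * Complex.I)‖ * Real.exp (π * |t+3*ρ| / 2))) * m * m := by gcongr
    _ = _ := by ring

lemma F1_strip {W : ℝ → ℂ} (hW : Nice W) (d k : ℕ) (hd2 : 2 ≤ d) (hd : 2 * k < d) (ρ : ℝ) {e A : ℝ} (he : |e| ≤ 1) (hA : 0 < A)
    {l : ℝ} (hl : 0 < l) : ∃ C : ℝ, ∀ σ ∈ Icc l ((k:ℝ)+1/2), ∀ t : ℝ, ‖F1 W d ρ e A (σ + t * Complex.I)‖ ≤ C * (1+t^2)⁻¹ := by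
  obtain ⟨CM, hM0, hM⟩ := mellin_line hW (2*k+1) l (k+1/2)
  obtain ⟨CQ, hQ0, hQ⟩ := Q_strip d k hd2 hd
  obtain ⟨CG, hG0, hG⟩ := Gamma_strip k hl
  have hcA : ContinuousOn (fun σ : ℝ => A^(1-σ)) (Icc l (k+1/2)) := by
    apply Continuous.continuousOn
    exact Continuous.rpow continuous_const (by fun_prop) (fun _ => Or.inl hA.ne')
  obtain ⟨CA, hCA⟩ := isCompact_Icc.exists_bound_of_continuousOn hcA
  have hCA0 : ∀ σ ∈ Icc l ((k:ℝ)+1/2), A^(1-σ) ≤ |CA| := fun σ hσ => ((le_abs_self _).trans (hCA σ hσ)).trans (le_abs_self _)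
  refine ⟨|CA| * ((CQ * (d+2*k+1+|ρ|)^(2*k)) * (CG * (k+1/2+1+2*|ρ|)^k) * CM^2 * (1+|ρ|)^2), fun σ hσ t => ?_⟩
  have hX : 1 ≤ 1 + |t+ρ| := by linarith [abs_nonneg (t+ρ)]
  refine (F1_norm W d ρ he hA σ t).trans ?_
  have b1 := poly1 (d+2*k) t ρ (by positivity)
  have b2 := poly2 (k+1/2) t ρ (by positivity)
  have q : ‖Qfun d (σ + t * Complex.I)‖ ≤ (CQ * (d+2*k+1+|ρ|)^(2*k)) * (1+|t+ρ|)^(2*k) := by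
    refine (hQ σ ⟨hl.le.trans hσ.1, hσ.2⟩ t).trans ?_
    rw [mul_assoc, ← mul_pow]
    gcongr
  have g : ‖Complex.Gamma (σ + (t + 3*ρ : ℝ) * Complex.I)‖ * Real.exp (π * |t+3*ρ| / 2) ≤ (CG * (k+1/2+1+2*|ρ|)^k) * (1+|t+ρ|)^k := by
    refine (hG σ hσ (t+3*ρ)).trans ?_
    rw [mul_assoc, ← mul_pow]
    gcongr
  have hp := prod_bound k hX (norm_nonneg _) (by positivity) (by positivity) (by positivity) (hM σ hσ t ρ) q g
  have hinv : ((1+|t+ρ|)^2)⁻¹ ≤ (1+|ρ|)^2 * (1+t^2)⁻¹ := by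
    rw [← div_eq_mul_inv, le_div_iff₀ (by positivity), inv_mul_le_iff₀ (by positivity)]
    have := poly1 0 t ρ le_rfl
    have h3 : (1+|t|) ≤ (1+|ρ|) * (1+|t+ρ|) := by
      have h : |t| ≤ |t+ρ| + |ρ| := by
        have := abs_sub (t+ρ) ρ
        rwa [add_sub_cancel_right] at this
      nlinarith [mul_nonneg (abs_nonneg ρ) (abs_nonneg (t+ρ))]
    have h4 := pow_le_pow_left₀ (by positivity) h3 2
    have h5 : (1+|t|)^2 = 1 + 2*|t| + t^2 := by rw [add_sq, sq_abs]; ring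
    nlinarith [abs_nonneg t]
  calc _ ≤ |CA| * ((CQ * (d+2*k+1+|ρ|)^(2*k)) * (CG * (k+1/2+1+2*|ρ|)^k) * CM^2 * ((1+|t+ρ|)^2)⁻¹) := by
        refine mul_le_mul (hCA0 σ hσ) hp (by positivity) (abs_nonneg _)
    _ ≤ |CA| * ((CQ * (d+2*k+1+|ρ|)^(2*k)) * (CG * (k+1/2+1+2*|ρ|)^k) * CM^2 * ((1+|ρ|)^2 * (1+t^2)⁻¹)) := by gcongr
    _ = _ := by ring

/-- the constant -/
def I0 : ℝ := ∫ u : ℝ, ((1+|u|)^2)⁻¹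

lemma I0_int : Integrable (fun u : ℝ => ((1+|u|)^2)⁻¹) := by
  have h : Integrable (fun x : ℝ => (1 + ‖x‖) ^ (-(2:ℝ))) := integrable_one_add_norm (by simp)
  refine h.congr (Filter.Eventually.of_forall fun x => ?_)
  simp only [Real.norm_eq_abs]
  rw [Real.rpow_neg (by positivity), Real.rpow_two]

lemma I0_nonneg : 0 ≤ I0 := integral_nonneg fun u => by positivity

lemma K_bound {W : ℝ → ℂ} (hW : Nice W) (d k : ℕ) (hd2 : 2 ≤ d) (hd : 2 * k < d) (ρ Ξ : ℝ) (hΞ : 1 < |Ξ|)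
    {σ D : ℝ} (hσ : 0 < σ) (hσk : σ ≤ k + 1/2) (hD : 0 ≤ D)
    (hb : ∀ t : ℝ, ‖F1 W d ρ (Real.sign Ξ) (8 * π^3 * |Ξ|) (σ + t * Complex.I)‖ ≤
      (8 * π^3 * |Ξ|)^(1-σ) * (D * ((1+|t+ρ|)^2)⁻¹)) :
    ‖Ktilde W d (ρ * Complex.I) Ξ 0 0‖ ≤ 8 * π^3 * I0 * D * |Ξ|^(-σ) := by
  have hX0 : 0 < |Ξ| := by linarith
  have hA : 0 < 8 * π^3 * |Ξ| := by positivity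
  have he := sign_abs_le Ξ
  have hk : (0:ℝ) ≤ k := by positivity
  rw [Ktilde_eq hW d hd2 ρ Ξ hΞ]
  set F := F1 W d ρ (Real.sign Ξ) (8 * π^3 * |Ξ|) with hF
  have sh : ∀ l : ℝ, 0 < l → l ≤ k + 1/2 → ∫ t : ℝ, F (l + t * Complex.I) = ∫ t : ℝ, F ((k+1/2:ℝ) + t * Complex.I) := by
    intro l hl hlk
    obtain ⟨C, hC⟩ := F1_strip hW d k hd2 hd ρ he hA hl
    refine shift_line F hlk ?_ C hC
    intro s hs
    exact (F1_diff hW d hd2 ρ _ hA (hl.trans_le hs.1)).differentiableWithinAt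
  rw [sh (1/12) (by norm_num) (by linarith), ← sh σ hσ hσk, norm_mul, norm_mul]
  have hi : ‖∫ t : ℝ, F (σ + t * Complex.I)‖ ≤ (8 * π^3 * |Ξ|)^(1-σ) * (D * I0) := by
    have h1 := norm_integral_le_of_norm_le (((I0_int.comp_add_right ρ).const_mul D).const_mul ((8 * π^3 * |Ξ|)^(1-σ))) (Filter.Eventually.of_forall hb)
    rwa [integral_const_mul, integral_const_mul, integral_add_right_eq_self (fun u : ℝ => ((1+|u|)^2)⁻¹) ρ] at h1
  have hc : ‖((Real.sign Ξ : ℂ) * Complex.I) ^ d / (4 * (Real.pi : ℂ) ^ 2) * (1 / (2 * (Real.pi : ℂ)))‖ ≤ 1 := by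
    have hpi : (1:ℝ) ≤ π := by linarith [Real.pi_gt_three]
    have h2 : (1:ℝ) ≤ π^2 := one_le_pow₀ hpi
    have h3 : |Real.sign Ξ|^d ≤ 1 := pow_le_one₀ (abs_nonneg _) he
    simp only [norm_mul, norm_div, norm_pow, Complex.norm_I, mul_one, Complex.norm_real, Real.norm_eq_abs, abs_of_pos Real.pi_pos, Complex.norm_ofNat, norm_one]
    have h4 : |Real.sign Ξ|^d / (4 * π^2) ≤ 1 := by
      rw [div_le_one (by positivity)]; linarith
    have h5 : 1/(2*π) ≤ 1 := by
      rw [div_le_one (by positivity)]; linarith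
    exact mul_le_one₀ h4 (by positivity) h5
  have hn : ‖(1:ℂ) / ((|Ξ| : ℝ) : ℂ)‖ = |Ξ|⁻¹ := by simp
  rw [hn]
  have h8 : (8 * π^3 : ℝ)^(1-σ) ≤ 8 * π^3 := by
    have hpi : (1:ℝ) ≤ π := by linarith [Real.pi_gt_three]
    have h2 : (1:ℝ) ≤ π^3 := one_le_pow₀ hpi
    have := Real.rpow_le_rpow_of_exponent_le (show (1:ℝ) ≤ 8 * π^3 by linarith) (show 1 - σ ≤ 1 by linarith)
    rwa [Real.rpow_one] at this
  have hs : |Ξ|⁻¹ * |Ξ|^(1-σ) = |Ξ|^(-σ) := by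
    rw [← Real.rpow_neg_one, ← Real.rpow_add hX0]; congr 1; ring
  have hI := I0_nonneg
  calc _ ≤ |Ξ|⁻¹ * (1 * ((8 * π^3 * |Ξ|)^(1-σ) * (D * I0))) := by gcongr
    _ = (8*π^3)^(1-σ) * (|Ξ|⁻¹ * |Ξ|^(1-σ)) * (D * I0) := by
        rw [Real.mul_rpow (by positivity) hX0.le]; ring
    _ ≤ (8*π^3) * |Ξ|^(-σ) * (D * I0) := by rw [hs]; gcongr
    _ = _ := by ring

lemma part_i {W : ℝ → ℂ} (hW : Nice W) (c1 c2 ε0 : ℝ) (hc1 : 0 < c1) (hε : 0 < ε0) :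
    ∃ C : ℝ, ∀ T : ℝ, 1 < T → ∀ d : ℕ, 2 ≤ d → c1 * T ≤ (d : ℝ) → (d : ℝ) ≤ c2 * T →
          ∀ ρ : ℝ, c1 * T ≤ |ρ| → |ρ| ≤ c2 * T → ∀ Ξ : ℝ, 1 < |Ξ| →
              ‖Ktilde W d ((ρ : ℂ) * Complex.I) Ξ 0 0‖ ≤ C * T ^ (-(3 : ℝ) / 2 + ε0) := by
  obtain ⟨σ, hσ0, hσ1, hσ2⟩ : ∃ σ : ℝ, 0 < σ ∧ σ ≤ 1/12 ∧ 3 * σ ≤ ε0 :=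
    ⟨min (ε0/3) (1/12), by positivity, min_le_right _ _, by linarith [min_le_left (ε0/3) (1/12:ℝ)]⟩
  obtain ⟨CM, hM0, hM⟩ := mellin_line hW 2 σ σ
  set D0 := 3 * (c1/2)^(-(1-2*σ)) * (3/(2*σ) * c1^(-(1/2-σ))) * CM^2 with hD0
  have hI := I0_nonneg
  refine ⟨8 * π^3 * I0 * D0, fun T hT d hd hd1 _ ρ hρ1 _ Ξ hΞ => ?_⟩
  have hT0 : 0 < T := by linarith
  set D := D0 * T^(-(3:ℝ)/2 + 3*σ) with hD
  have hDn : 0 ≤ D := by positivity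
  have key := K_bound hW d 0 hd (by omega) ρ Ξ hΞ hσ0 (by norm_num; linarith) hDn ?_
  · refine key.trans ?_
    have h1 : |Ξ|^(-σ) ≤ 1 := Real.rpow_le_one_of_one_le_of_nonpos hΞ.le (by linarith)
    have h2 : T^(-(3:ℝ)/2 + 3*σ) ≤ T^(-(3:ℝ)/2 + ε0) := Real.rpow_le_rpow_of_exponent_le hT.le (by linarith)
    calc _ ≤ 8 * π^3 * I0 * D * 1 := by gcongr
      _ = 8 * π^3 * I0 * D0 * T^(-(3:ℝ)/2 + 3*σ) := by rw [hD]; ring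
      _ ≤ _ := by gcongr
  · intro t
    refine (F1_norm W d ρ (sign_abs_le Ξ) (by positivity) σ t).trans ?_
    refine mul_le_mul_of_nonneg_left ?_ (by positivity)
    have hX : 1 ≤ 1 + |t+ρ| := by linarith [abs_nonneg (t+ρ)]
    have hm := hM σ ⟨le_rfl, le_rfl⟩ t ρ
    set X := 1 + |t+ρ| with hXd
    set m := ‖mellin W (2 - ρ * Complex.I - (σ + t * Complex.I))‖
    have hm0 : 0 ≤ m := norm_nonneg _
    have q := Q_small d hd hσ0 (by linarith) t
    have g := Gamma_small hσ0 (by linarith) (t+3*ρ)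
    have q2 : ‖((((d:ℝ)+1)/2 - σ : ℝ):ℂ) + t * Complex.I‖ ^ (-(1-2*σ)) ≤ (c1/2)^(-(1-2*σ)) * T^(-(1-2*σ)) := by
      have a1 := le_norm_re (((d:ℝ)+1)/2 - σ) t
      have a3 : (c1/2) * T ≤ ‖((((d:ℝ)+1)/2 - σ : ℝ):ℂ) + t * Complex.I‖ := by linarith
      rw [← Real.mul_rpow (by positivity) hT0.le]
      exact Real.rpow_le_rpow_of_nonpos (by positivity) a3 (by linarith)
    have g2 : ‖((1/2:ℝ):ℂ) + (t+3*ρ:ℝ) * Complex.I‖ ^ (-(1/2-σ)) ≤ c1^(-(1/2-σ)) * T^(-(1/2-σ)) * X := by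
      have a1 := le_norm_re (1/2) (t+3*ρ)
      have a2 := le_norm_im (1/2) (t+3*ρ)
      set n := ‖((1/2:ℝ):ℂ) + (t+3*ρ:ℝ) * Complex.I‖
      have a4 : 2*|ρ| ≤ |t+3*ρ| + |t+ρ| := by
        have := abs_sub (t+3*ρ) (t+ρ)
        rw [show t + 3*ρ - (t+ρ) = 2*ρ by ring, abs_mul] at this
        simpa using this
      have a3 : c1 * T / X ≤ n := by
        rw [div_le_iff₀ (by linarith), hXd]
        nlinarith [abs_nonneg (t+ρ)]
      have a5 := Real.rpow_le_rpow_of_nonpos (by positivity) a3 (show -(1/2-σ) ≤ 0 by linarith)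
      refine a5.trans ?_
      rw [Real.div_rpow (by positivity) (by linarith), Real.mul_rpow hc1.le hT0.le, div_eq_mul_inv, ← Real.rpow_neg (by linarith)]
      gcongr
      have := Real.rpow_le_rpow_of_exponent_le hX (show - -(1/2-σ) ≤ 1 by linarith)
      rwa [Real.rpow_one] at this
    have q3 := q.trans (mul_le_mul_of_nonneg_left q2 (by norm_num : (0:ℝ) ≤ 3))
    have g3 := g.trans (mul_le_mul_of_nonneg_left g2 (by positivity : 0 ≤ 3/(2*σ)))
    have hmm : X * m * m ≤ CM^2 * (X^2)⁻¹ := by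
      rw [← div_eq_mul_inv, le_div_iff₀ (by positivity)]
      have h1 : (m * X^2)^2 ≤ CM^2 := pow_le_pow_left₀ (by positivity) hm 2
      have h2 : X^3 ≤ X^4 := pow_le_pow_right₀ hX (by omega)
      calc X * m * m * X^2 = m^2 * X^3 := by ring
        _ ≤ m^2 * X^4 := by gcongr
        _ = (m * X^2)^2 := by ring
        _ ≤ _ := h1
    have hTT : T^(-(1-2*σ)) * T^(-(1/2-σ)) = T^(-(3:ℝ)/2 + 3*σ) := by
      rw [← Real.rpow_add hT0]; congr 1; ring
    calc _ ≤ (3 * ((c1/2)^(-(1-2*σ)) * T^(-(1-2*σ)))) * (3/(2*σ) * (c1^(-(1/2-σ)) * T^(-(1/2-σ)) * X)) * m * m := by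
          refine mul_le_mul_of_nonneg_right (mul_le_mul_of_nonneg_right (mul_le_mul q3 g3 (by positivity) (by positivity)) hm0) hm0
      _ = 3 * (c1/2)^(-(1-2*σ)) * (3/(2*σ) * c1^(-(1/2-σ))) * (T^(-(1-2*σ)) * T^(-(1/2-σ))) * (X * m * m) := by ring
      _ ≤ 3 * (c1/2)^(-(1-2*σ)) * (3/(2*σ) * c1^(-(1/2-σ))) * (T^(-(1-2*σ)) * T^(-(1/2-σ))) * (CM^2 * (X^2)⁻¹) := by gcongr
      _ = D * (X^2)⁻¹ := by rw [hTT, hD, hD0]; ring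

lemma part_ii {W : ℝ → ℂ} (hW : Nice W) (c1 c2 ε0 : ℝ) (hc1 : 0 < c1) (hc12 : c1 ≤ c2) (hε : 0 < ε0) (B : ℝ) (hB : 0 ≤ B) :
    ∃ C' : ℝ, ∀ T : ℝ, 1 < T → ∀ d : ℕ, 2 ≤ d → c1 * T ≤ (d : ℝ) → (d : ℝ) ≤ c2 * T →
          ∀ ρ : ℝ, c1 * T ≤ |ρ| → |ρ| ≤ c2 * T → ∀ Ξ : ℝ, 1 < |Ξ| → T ^ ((3 : ℝ) + ε0) ≤ |Ξ| →
              ‖Ktilde W d ((ρ : ℂ) * Complex.I) Ξ 0 0‖ ≤ C' * T ^ (-B) := by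
  obtain ⟨C, hC⟩ := part_i hW c1 c2 ε0 hc1 hε
  obtain ⟨k, hk⟩ := exists_nat_ge (B/ε0)
  rw [div_le_iff₀ hε] at hk
  obtain ⟨CM, hM0, hM⟩ := mellin_line hW (2*k+1) (k+1/2) (k+1/2)
  have hc2 : 0 < c2 := by linarith
  set a0 := 2*c2 + 2*k + 2 with ha0
  have ha0p : 0 < a0 := by positivity
  set D0 := a0^(2*k) * (3 * a0^k) * CM^2 with hD0
  set T0 := (2*k+1)/c1 with hT0def
  have hI := I0_nonneg
  refine ⟨|C| * (max T0 1)^(ε0+B) + 8 * π^3 * I0 * D0, fun T hT d hd hd1 hd2 ρ hρ1 hρ2 Ξ hΞ hΞT => ?_⟩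
  have hT0 : 0 < T := by linarith
  rcases le_or_gt T T0 with h | h
  · refine (hC T hT d hd hd1 hd2 ρ hρ1 hρ2 Ξ hΞ).trans ?_
    have h1 : T^(-(3:ℝ)/2 + ε0) ≤ T^(ε0 + B) * T^(-B) := by
      rw [← Real.rpow_add hT0]
      exact Real.rpow_le_rpow_of_exponent_le hT.le (by linarith)
    have h2 : T^(ε0+B) ≤ (max T0 1)^(ε0+B) := Real.rpow_le_rpow hT0.le (h.trans (le_max_left _ _)) (by linarith)
    calc C * T^(-(3:ℝ)/2 + ε0) ≤ |C| * T^(-(3:ℝ)/2 + ε0) := by gcongr; exact le_abs_self C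
      _ ≤ |C| * ((max T0 1)^(ε0+B) * T^(-B)) := by
          gcongr
          exact h1.trans (by gcongr)
      _ ≤ _ := by
          rw [← mul_assoc]
          gcongr
          have : 0 ≤ 8 * π^3 * I0 * D0 := by positivity
          linarith
  · have hdk : 2 * k < d := by
      have : (2*k+1:ℝ) < c1 * T := by
        rw [hT0def, div_lt_iff₀ hc1] at h; linarith
      have : (2*k+1:ℝ) < d := by linarith
      have : 2*k+1 < d := by exact_mod_cast this
      omega
    set D := D0 * T^(3*k) with hD
    have hDn : 0 ≤ D := by positivity
    have key := K_bound hW d k hd hdk ρ Ξ hΞ (σ := k+1/2) (by positivity) le_rfl hDn ?_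
    · refine key.trans ?_
      have h1 : |Ξ|^(-((k:ℝ)+1/2)) ≤ |Ξ|^(-(k:ℝ)) := Real.rpow_le_rpow_of_exponent_le hΞ.le (by linarith)
      have h2 : |Ξ|^(-(k:ℝ)) ≤ (T^((3:ℝ)+ε0))^(-(k:ℝ)) := Real.rpow_le_rpow_of_nonpos (by positivity) hΞT (by simp)
      rw [← Real.rpow_mul hT0.le] at h2
      have h3 : T^(3*k) * T^(((3:ℝ)+ε0) * -(k:ℝ)) ≤ T^(-B) := by
        rw [← Real.rpow_natCast, ← Real.rpow_add hT0]
        apply Real.rpow_le_rpow_of_exponent_le hT.le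
        push_cast
        linarith
      calc _ ≤ 8 * π^3 * I0 * D * T^(((3:ℝ)+ε0) * -(k:ℝ)) := by
            gcongr
            exact h1.trans h2
        _ = 8 * π^3 * I0 * D0 * (T^(3*k) * T^(((3:ℝ)+ε0) * -(k:ℝ))) := by rw [hD]; ring
        _ ≤ 8 * π^3 * I0 * D0 * T^(-B) := by gcongr
        _ ≤ _ := by
          gcongr
          have : 0 ≤ |C| * (max T0 1)^(ε0+B) := by positivity
          linarith
    · intro t
      refine (F1_norm W d ρ (sign_abs_le Ξ) (by positivity) (k+1/2) t).trans ?_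
      refine mul_le_mul_of_nonneg_left ?_ (by positivity)
      have hX : 1 ≤ 1 + |t+ρ| := by linarith [abs_nonneg (t+ρ)]
      have hm := hM (k+1/2) ⟨le_rfl, le_rfl⟩ t ρ
      have b1 := poly1 (d+2*k) t ρ (by positivity)
      have b2 := poly2 (k+1/2) t ρ (by positivity)
      have hkT : (k:ℝ) ≤ k * T := le_mul_of_one_le_right (by positivity) hT.le
      have e1 : (d:ℝ)+2*k+1+|ρ| ≤ a0 * T := by rw [ha0]; linarith
      have e2 : (k:ℝ)+1/2+1+2*|ρ| ≤ a0 * T := by rw [ha0]; linarith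
      have q : ‖Qfun d ((k+1/2:ℝ) + t * Complex.I)‖ ≤ (a0*T)^(2*k) * (1+|t+ρ|)^(2*k) := by
        refine (Q_int d k hdk t).trans ?_
        rw [← mul_pow]
        gcongr
        exact b1.trans (by gcongr)
      have g : ‖Complex.Gamma ((k+1/2:ℝ) + (t + 3*ρ : ℝ) * Complex.I)‖ * Real.exp (π * |t+3*ρ| / 2) ≤ (3 * (a0*T)^k) * (1+|t+ρ|)^k := by
        refine (Gamma_int k (t+3*ρ)).trans ?_
        rw [mul_assoc, ← mul_pow]
        gcongr
        exact b2.trans (by gcongr)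
      have hp := prod_bound k hX (norm_nonneg _) (by positivity) (by positivity) (by positivity) hm q g
      refine hp.trans (le_of_eq ?_)
      rw [hD, hD0]; ring

/-- Lemma 5(b): let `W` be smooth and compactly supported in
`(0, ∞)`, and fix `0 < c₁ ≤ c₂` and `ε > 0`. (i) There is `C` such that for all
`T > 1`, `d ≍ T`, `r = iρ` with `|ρ| ≍ T` and `|Ξ| > 1`:
`|K̃_{d,r}(Ξ, 0, 0)| ≤ C T^{−3/2+ε}`. (ii) For every `B ≥ 0` there is `C'` such that
if in addition `|Ξ| ≥ T^{3+ε}` then `|K̃_{d,r}(Ξ, 0, 0)| ≤ C' T^{−B}`. -/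
theorem statement18 (W : ℝ → ℂ) (hW : ContDiff ℝ (⊤ : ℕ∞) W)
    (hWc : HasCompactSupport W) (hWs : tsupport W ⊆ Set.Ioi (0 : ℝ))
    (c1 c2 ε0 : ℝ) (hc1 : 0 < c1) (hc12 : c1 ≤ c2) (hε : 0 < ε0) :
    (∃ C : ℝ,
      ∀ T : ℝ, 1 < T →
        ∀ d : ℕ, 2 ≤ d → c1 * T ≤ (d : ℝ) → (d : ℝ) ≤ c2 * T →
          ∀ ρ : ℝ, c1 * T ≤ |ρ| → |ρ| ≤ c2 * T →
            ∀ Ξ : ℝ, 1 < |Ξ| →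
              ‖Ktilde W d ((ρ : ℂ) * Complex.I) Ξ 0 0‖ ≤ C * T ^ (-(3 : ℝ) / 2 + ε0)) ∧
    (∀ B : ℝ, 0 ≤ B → ∃ C' : ℝ,
      ∀ T : ℝ, 1 < T →
        ∀ d : ℕ, 2 ≤ d → c1 * T ≤ (d : ℝ) → (d : ℝ) ≤ c2 * T →
          ∀ ρ : ℝ, c1 * T ≤ |ρ| → |ρ| ≤ c2 * T →
            ∀ Ξ : ℝ, 1 < |Ξ| → T ^ ((3 : ℝ) + ε0) ≤ |Ξ| →
              ‖Ktilde W d ((ρ : ℂ) * Complex.I) Ξ 0 0‖ ≤ C' * T ^ (-B)) := by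
  exact ⟨part_i ⟨hW, hWc, hWs⟩ c1 c2 ε0 hc1 hε,
    fun B hB => part_ii ⟨hW, hWc, hWs⟩ c1 c2 ε0 hc1 hc12 hε B hB⟩
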